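/- Fix ρ > 0, integers M ≥ 0 and N ≥ 1, positive reals c_0, …, c_{N−1}, and a matrix A ∈ 𝒫_N(D̄(0,ρ)). Let A_0 := c_0·1_{N×N} + c_1 A + ⋯ + c_{N−1} A^{∘(N−1)} and A_m := A^{∘(N−1+m)} for 1 ≤ m ≤ M+1, and let 𝒰[η] := { A_0 + Σ_{m=1}^{M+1} u_m A_m : u_m ∈ [−η, η] } for η > 0. Then: if η ≤ (Σ_{m=0}^{M} 𝒞(c; z^{N+m}; N, ρ))^{−1}, then every matrix in 𝒰[η] is positive semidefinite; and conversely, if every matrix in 𝒰[η] is positive semidefinite for every A ∈ 𝒫_N(D̄(0,ρ)), then η ≤ 𝒞(c; z^{N+M}; N, ρ)^{−1}. -/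

import Mathlib

open scoped ComplexOrder

noncomputable section

/-- The `k`-th Hadamard (entrywise) power of a matrix. -/
def hadPow {N : ℕ} (A : Matrix (Fin N) (Fin N) ℂ) (k : ℕ) : Matrix (Fin N) (Fin N) ℂ :=
  Matrix.of fun i j => A i j ^ k

/-- The constant `𝒞(c; z^M; N, ρ)`. -/
def CC (N : ℕ) (c : Fin N → ℝ) (M : ℕ) (ρ : ℝ) : ℝ :=
  ∑ j : Fin N, (M.choose j : ℝ) ^ 2 * ((M - (j : ℕ) - 1).choose (N - (j : ℕ) - 1) : ℝ) ^ 2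
    * ρ ^ (M - (j : ℕ)) / c j

/-- The coefficients of the remainder of `z ^ (n + k - 1)` modulo `∏ i < n, (z - w i)`. -/
def remCoeff {R : Type*} [CommRing R] (w : ℕ → R) : ℕ → ℕ → ℕ → R
  | 0, _, _ => 0
  | n + 1, 0, j => if j = n then 1 else 0
  | n + 1, k + 1, 0 => -(w n * remCoeff w n (k + 1) 0) + w n * remCoeff w (n + 1) k 0
  | n + 1, k + 1, j + 1 => remCoeff w n (k + 1) j - w n * remCoeff w n (k + 1) (j + 1)
      + w n * remCoeff w (n + 1) k (j + 1)
termination_by n k => n + k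

/-- The sum of the absolute values of the coefficients of `remCoeff`, as polynomials in the
nodes. -/
def remCount : ℕ → ℕ → ℕ → ℕ
  | 0, _, _ => 0
  | n + 1, 0, j => if j = n then 1 else 0
  | n + 1, k + 1, 0 => remCount n (k + 1) 0 + remCount (n + 1) k 0
  | n + 1, k + 1, j + 1 => remCount n (k + 1) j + remCount n (k + 1) (j + 1)
      + remCount (n + 1) k (j + 1)
termination_by n k => n + k

theorem remCoeff_eq_zero {R : Type*} [CommRing R] (w : ℕ → R) (n k j : ℕ) (h : n ≤ j) :
    remCoeff w n k j = 0 := by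
  fun_induction remCoeff w n k j with
  | case1 => rfl
  | case2 => omega
  | case3 => rfl
  | case4 => omega
  | case5 n k j h1 h2 h3 => rw [h1 (by omega), h2 (by omega), h3 (by omega)]; simp

theorem remCount_eq_zero (n k j : ℕ) (h : n ≤ j) : remCount n k j = 0 := by
  fun_induction remCount n k j with
  | case1 => rfl
  | case2 => omega
  | case3 => rfl
  | case4 => omega
  | case5 n k j h1 h2 h3 => rw [h1 (by omega), h2 (by omega), h3 (by omega)]

theorem sum_remCoeff_succ {R : Type*} [CommRing R] (w : ℕ → R) (n k : ℕ) (z : R) :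
    ∑ j ∈ Finset.range (n + 1), remCoeff w (n + 1) (k + 1) j * z ^ j =
      (z - w n) * ∑ j ∈ Finset.range n, remCoeff w n (k + 1) j * z ^ j
        + w n * ∑ j ∈ Finset.range (n + 1), remCoeff w (n + 1) k j * z ^ j := by
  have h : ∑ j ∈ Finset.range n, remCoeff w n (k + 1) j * z ^ j
      = ∑ j ∈ Finset.range (n + 1), remCoeff w n (k + 1) j * z ^ j := by
    rw [Finset.sum_range_succ, remCoeff_eq_zero w n (k + 1) n le_rfl]; simp
  rw [sub_mul]
  nth_rw 2 [h]
  rw [Finset.sum_range_succ', Finset.sum_range_succ', Finset.sum_range_succ']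
  simp only [remCoeff, mul_add, Finset.mul_sum, add_mul, sub_mul, Finset.sum_add_distrib,
    Finset.sum_sub_distrib, pow_succ]
  simp only [mul_comm, mul_left_comm, mul_assoc]
  ring

theorem pow_eq_sum_remCoeff {R : Type*} [CommRing R] (w : ℕ → R) (k n i : ℕ) (hi : i ≤ n) :
    w i ^ (n + k) = ∑ j ∈ Finset.range (n + 1), remCoeff w (n + 1) k j * w i ^ j := by
  induction n generalizing k with
  | zero =>
    obtain rfl : i = 0 := by omega
    induction k with
    | zero => simp [remCoeff]
    | succ k ih =>
      rw [sum_remCoeff_succ, ← ih]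
      simp only [sub_self, zero_mul, zero_add]
      ring
  | succ n ihn =>
    induction k with
    | zero => simp [remCoeff]
    | succ k ih =>
      rw [sum_remCoeff_succ, ← ih]
      obtain rfl | h := Nat.eq_or_lt_of_le hi
      · ring
      · rw [← ihn (k + 1) (by omega)]
        ring

theorem remCount_eq (n k j : ℕ) (hj : j ≤ n) :
    remCount (n + 1) k j = (n + k).choose j * (n + k - j - 1).choose (n - j) := by
  induction n generalizing k j with
  | zero =>
    obtain rfl : j = 0 := by omega
    induction k with
    | zero => simp [remCount]
    | succ k ih => simp [remCount, ih]
  | succ n ihn =>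
    induction k generalizing j with
    | zero =>
      rw [remCount]
      split_ifs with h
      · subst h; simp
      · rw [Nat.choose_eq_zero_of_lt (by omega : n + 1 + 0 - j - 1 < n + 1 - j)]; simp
    | succ k ih =>
      cases j with
      | zero =>
        rw [remCount, ih _ (by omega), ihn _ _ (by omega)]
        simp only [Nat.choose_zero_right, one_mul, Nat.sub_zero]
        rw [show n + 1 + (k + 1) - 1 = (n + k) + 1 by omega, Nat.choose_succ_succ,
          show n + 1 + k - 1 = n + k by omega]
        rfl
      | succ j =>
        rw [remCount, ih _ (by omega), ihn _ _ (by omega)]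
        obtain ⟨b, rfl⟩ : ∃ b, n = j + b := ⟨n - j, by omega⟩
        rw [show j + b + 1 + (k + 1) = (j + b + k + 1) + 1 by omega, Nat.choose_succ_succ _ j,
          show j + b + k + 1 + 1 - (j + 1) - 1 = b + k by omega,
          show j + b + (k + 1) = j + b + k + 1 by omega,
          show j + b + k + 1 - j - 1 = b + k by omega,
          show j + b + 1 + k = j + b + k + 1 by omega,
          show j + b - j = b by omega, show j + b + 1 - (j + 1) = b by omega, add_mul, add_assoc]
        congr 1
        cases b with
        | zero => rw [remCount_eq_zero _ _ _ (by omega)]; simp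
        | succ b =>
          rw [ihn _ _ (by omega), show b + 1 + k = (b + k) + 1 by omega, Nat.choose_succ_succ (b + k) b,
            show j + (b + 1) + (k + 1) = j + (b + 1) + k + 1 by omega,
            show j + (b + 1) + k + 1 - (j + 1) - 1 = b + k by omega,
            show j + (b + 1) - (j + 1) = b by omega]
          ring

theorem remCoeff_const {R : Type*} [CommRing R] (s : R) (n k j e : ℕ) (h : j + e + 1 = n + k) :
    remCoeff (fun _ => s) n k j = (-1) ^ (n + j + 1) * remCount n k j * s ^ e := by
  induction n generalizing k j e with
  | zero => simp [remCoeff, remCount]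
  | succ n ihn =>
    induction k generalizing j e with
    | zero =>
      rw [remCoeff, remCount]
      split_ifs with hj
      · subst hj
        obtain rfl : e = 0 := by omega
        have : Even (j + 1 + j + 1) := ⟨j + 1, by omega⟩
        simp [this.neg_one_pow]
      · simp
    | succ k ih =>
      by_cases hj : n + 1 ≤ j
      · rw [remCoeff_eq_zero _ _ _ _ hj, remCount_eq_zero _ _ _ hj]; simp
      obtain ⟨e, rfl⟩ : ∃ d, e = d + 1 := ⟨e - 1, by omega⟩
      cases j with
      | zero =>
        rw [remCoeff, remCount, ihn (k + 1) 0 e (by omega), ih 0 e (by omega)]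
        push_cast
        ring
      | succ j =>
        rw [remCoeff, remCount, ihn (k + 1) (j + 1) e (by omega), ih (j + 1) e (by omega),
          ihn (k + 1) j (e + 1) (by omega)]
        push_cast
        ring

theorem continuous_remCoeff (w : ℝ → ℕ → ℝ) (hw : ∀ i, Continuous fun ε => w ε i) (n k j : ℕ) :
    Continuous fun ε => remCoeff (w ε) n k j := by
  induction n generalizing k j with
  | zero => simp only [remCoeff]; fun_prop
  | succ n ihn =>
    induction k generalizing j with
    | zero => simp only [remCoeff]; fun_prop
    | succ k ih =>
      have := hw n
      cases j with
      | zero =>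
        have h1 := ihn (k + 1) 0
        have h2 := ih 0
        simp only [remCoeff]; fun_prop
      | succ j =>
        have h1 := ihn (k + 1) (j + 1)
        have h2 := ih (j + 1)
        have h3 := ihn (k + 1) j
        simp only [remCoeff]; fun_prop

section Bombieri

open MvPolynomial

/-- The norm of the degree-`n` homogeneous part of a polynomial for which
`⟪x ^ n, y ^ n⟫ = ⟪x, y⟫ ^ n` for linear forms `x`, `y`. -/
def bombieri {d : ℕ} : ℕ → MvPolynomial (Fin d) ℂ → ℝ
  | 0, p => ‖constantCoeff p‖
  | n + 1, p => √(∑ i, bombieri n (pderiv i p) ^ 2) / (n + 1)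

theorem sqrt_sum_add_sq_le {ι : Type*} [Fintype ι] (f g : ι → ℝ) :
    √(∑ i, (f i + g i) ^ 2) ≤ √(∑ i, f i ^ 2) + √(∑ i, g i ^ 2) := by
  have h := norm_add_le (WithLp.toLp 2 f : EuclideanSpace ℝ ι) (WithLp.toLp 2 g)
  simpa [EuclideanSpace.norm_eq] using h

theorem sqrt_sum_mul_sq {ι : Type*} [Fintype ι] (a : ℝ) (ha : 0 ≤ a) (f : ι → ℝ) :
    √(∑ i, (a * f i) ^ 2) = a * √(∑ i, f i ^ 2) := by
  simp_rw [mul_pow]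
  rw [← Finset.mul_sum, Real.sqrt_mul (by positivity), Real.sqrt_sq ha]

theorem sqrt_sum_sq_le {ι : Type*} [Fintype ι] {f g : ι → ℝ} (hf : ∀ i, 0 ≤ f i)
    (h : ∀ i, f i ≤ g i) : √(∑ i, f i ^ 2) ≤ √(∑ i, g i ^ 2) :=
  Real.sqrt_le_sqrt (Finset.sum_le_sum fun i _ => pow_le_pow_left₀ (hf i) (h i) 2)

variable {d : ℕ}

theorem bombieri_nonneg (n : ℕ) (p : MvPolynomial (Fin d) ℂ) : 0 ≤ bombieri n p := by
  cases n <;> rw [bombieri] <;> positivity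

theorem bombieri_add_le (n : ℕ) (p q : MvPolynomial (Fin d) ℂ) :
    bombieri n (p + q) ≤ bombieri n p + bombieri n q := by
  induction n generalizing p q with
  | zero => simpa [bombieri] using norm_add_le _ _
  | succ n ih =>
    simp only [bombieri, map_add]
    rw [← add_div]
    gcongr
    exact (sqrt_sum_sq_le (fun i => bombieri_nonneg _ _) fun i => ih _ _).trans
      (sqrt_sum_add_sq_le _ _)

theorem bombieri_C_mul (n : ℕ) (a : ℂ) (p : MvPolynomial (Fin d) ℂ) :
    bombieri n (C a * p) = ‖a‖ * bombieri n p := by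
  induction n generalizing p with
  | zero => simp [bombieri]
  | succ n ih =>
    simp only [bombieri, pderiv_C_mul, ih]
    rw [sqrt_sum_mul_sq _ (norm_nonneg a), mul_div_assoc]

theorem bombieri_zero (n : ℕ) : bombieri n (0 : MvPolynomial (Fin d) ℂ) = 0 := by
  simpa using bombieri_C_mul n 0 (0 : MvPolynomial (Fin d) ℂ)

theorem bombieri_neg (n : ℕ) (p : MvPolynomial (Fin d) ℂ) : bombieri n (-p) = bombieri n p := by
  simpa using bombieri_C_mul n (-1) p

theorem bombieri_sum_le {ι : Type*} (n : ℕ) (s : Finset ι) (p : ι → MvPolynomial (Fin d) ℂ) :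
    bombieri n (∑ i ∈ s, p i) ≤ ∑ i ∈ s, bombieri n (p i) :=
  Finset.le_sum_of_subadditive _ (bombieri_zero n).le (bombieri_add_le n) _ _

/-- The linear form with coefficients `b`. -/
def linForm (b : Fin d → ℂ) : MvPolynomial (Fin d) ℂ := ∑ i, C (b i) * X i

theorem pderiv_linForm (b : Fin d → ℂ) (i : Fin d) : pderiv i (linForm b) = C (b i) := by
  simp [linForm, pderiv_X, Pi.single_apply]

theorem constantCoeff_linForm (b : Fin d → ℂ) : constantCoeff (linForm b) = 0 := by
  simp [linForm]

theorem bombieri_linForm_mul_le (b : Fin d → ℂ) (n : ℕ) (p : MvPolynomial (Fin d) ℂ) :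
    bombieri (n + 1) (linForm b * p) ≤ √(∑ i, ‖b i‖ ^ 2) * bombieri n p := by
  induction n generalizing p with
  | zero =>
    apply le_of_eq
    simp only [bombieri, pderiv_mul, pderiv_linForm, map_add, map_mul, constantCoeff_C,
      constantCoeff_linForm, zero_mul, add_zero, norm_mul]
    simp_rw [mul_comm _ ‖constantCoeff p‖]
    rw [sqrt_sum_mul_sq _ (norm_nonneg _)]
    simp
  | succ n ih =>
    set β := √(∑ i, ‖b i‖ ^ 2) with hβ
    have hp : √(∑ i, bombieri n (pderiv i p) ^ 2) = (n + 1) * bombieri (n + 1) p := by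
      rw [bombieri]; field_simp
    rw [bombieri, div_le_iff₀ (by positivity)]
    calc √(∑ i, bombieri (n + 1) (pderiv i (linForm b * p)) ^ 2)
        ≤ √(∑ i, (bombieri (n + 1) p * ‖b i‖ + β * bombieri n (pderiv i p)) ^ 2) := by
          refine sqrt_sum_sq_le (fun i => bombieri_nonneg _ _) fun i => ?_
          rw [pderiv_mul, pderiv_linForm]
          refine (bombieri_add_le _ _ _).trans (add_le_add ?_ (ih _))
          rw [bombieri_C_mul, mul_comm]
      _ ≤ _ := sqrt_sum_add_sq_le _ _
      _ = β * bombieri (n + 1) p * (↑(n + 1) + 1) := by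
          rw [sqrt_sum_mul_sq _ (bombieri_nonneg _ _), sqrt_sum_mul_sq _ (Real.sqrt_nonneg _), hp,
            ← hβ]
          push_cast
          ring

theorem bombieri_sum_pow_sq {ι : Type*} [Fintype ι] (b : ι → Fin d → ℂ) (n : ℕ) (v : ι → ℂ) :
    ((bombieri n (∑ l, C (v l) * linForm (b l) ^ n) ^ 2 : ℝ) : ℂ) =
      ∑ k, ∑ l, star (v k) * (∑ i, star (b k i) * b l i) ^ n * v l := by
  induction n generalizing v with
  | zero =>
    simp only [bombieri, pow_zero, mul_one, map_sum, constantCoeff_C]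
    rw [Complex.ofReal_pow, ← Complex.conj_mul', map_sum, Finset.sum_mul_sum]
    rfl
  | succ n ih =>
    have h (i : Fin d) : pderiv i (∑ l, C (v l) * linForm (b l) ^ (n + 1))
        = C ((n : ℂ) + 1) * ∑ l, C (v l * b l i) * linForm (b l) ^ n := by
      rw [map_sum, Finset.mul_sum]
      refine Finset.sum_congr rfl fun l _ => ?_
      rw [pderiv_C_mul, pderiv_pow, pderiv_linForm]
      simp
      ring
    have hn : ‖(n : ℂ) + 1‖ = (n : ℝ) + 1 := by
      exact_mod_cast Complex.norm_natCast (n + 1)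
    rw [bombieri]
    simp only [h, bombieri_C_mul, hn]
    rw [sqrt_sum_mul_sq _ (by positivity), mul_div_cancel_left₀ _ (by positivity),
      Real.sq_sqrt (by positivity), Complex.ofReal_sum]
    simp only [ih]
    rw [Finset.sum_comm]
    refine Finset.sum_congr rfl fun k _ => ?_
    rw [Finset.sum_comm]
    refine Finset.sum_congr rfl fun l _ => ?_
    rw [pow_succ, Finset.mul_sum, Finset.mul_sum, Finset.sum_mul]
    refine Finset.sum_congr rfl fun i _ => ?_
    rw [star_mul']
    ring

theorem bombieri_remCoeff_mul_le (b : ℕ → Fin d → ℂ) (σ : ℝ)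
    (hb : ∀ l, √(∑ i, ‖b l i‖ ^ 2) ≤ σ) (n k j e : ℕ) (h : j + e + 1 = n + k)
    (m : ℕ) (p : MvPolynomial (Fin d) ℂ) :
    bombieri (m + e) (remCoeff (fun l => linForm (b l)) n k j * p)
      ≤ remCount n k j * σ ^ e * bombieri m p := by
  have hmul (l r : ℕ) (q : MvPolynomial (Fin d) ℂ) :
      bombieri (r + 1) (linForm (b l) * q) ≤ σ * bombieri r q :=
    (bombieri_linForm_mul_le _ _ _).trans
      (mul_le_mul_of_nonneg_right (hb l) (bombieri_nonneg _ _))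
  have hσ : 0 ≤ σ := (Real.sqrt_nonneg _).trans (hb 0)
  induction n generalizing k j e with
  | zero => simp [remCoeff, remCount, bombieri_zero]
  | succ n ihn =>
    induction k generalizing j e with
    | zero =>
      rw [remCoeff, remCount]
      split_ifs with hj
      · obtain rfl : e = 0 := by omega
        simp
      · simp [bombieri_zero]
    | succ k ih =>
      by_cases hj : n + 1 ≤ j
      · rw [remCoeff_eq_zero _ _ _ _ hj, remCount_eq_zero _ _ _ hj]; simp [bombieri_zero]
      obtain ⟨e, rfl⟩ : ∃ d, e = d + 1 := ⟨e - 1, by omega⟩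
      have h1 := (hmul n (m + e) _).trans (mul_le_mul_of_nonneg_left (ihn (k + 1) j e (by omega)) hσ)
      have h2 := (hmul n (m + e) _).trans (mul_le_mul_of_nonneg_left (ih j e (by omega)) hσ)
      cases j with
      | zero =>
        rw [remCoeff, remCount, add_mul, neg_mul, mul_assoc, mul_assoc]
        refine (bombieri_add_le _ _ _).trans ?_
        rw [bombieri_neg]
        refine (add_le_add h1 h2).trans_eq ?_
        push_cast
        ring
      | succ j =>
        have h3 := ihn (k + 1) j (e + 1) (by omega)
        rw [remCoeff, remCount, add_mul, sub_mul, mul_assoc, mul_assoc, sub_eq_add_neg]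
        refine (bombieri_add_le _ _ _).trans ?_
        refine (add_le_add_left (bombieri_add_le _ _ _) _).trans ?_
        rw [bombieri_neg]
        refine (add_le_add (add_le_add h3 h1) h2).trans_eq ?_
        push_cast
        ring

theorem CC_eq_sum_remCount (n m : ℕ) (c : Fin (n + 1) → ℝ) (ρ : ℝ) :
    CC (n + 1) c (n + 1 + m) ρ =
      ∑ j : Fin (n + 1), (remCount (n + 1) (m + 1) j : ℝ) ^ 2 * ρ ^ (n + 1 + m - j) / c j := by
  refine Finset.sum_congr rfl fun j _ => ?_
  rw [remCount_eq _ _ _ (by omega), show n + (m + 1) = n + 1 + m by omega,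
    show n + 1 - (j : ℕ) - 1 = n - j by omega]
  push_cast
  ring

theorem CC_pos (N m : ℕ) (hN : 1 ≤ N) (c : Fin N → ℝ) (hc : ∀ j, 0 < c j) (ρ : ℝ) (hρ : 0 < ρ) :
    0 < CC N c (N + m) ρ := by
  have : Nonempty (Fin N) := ⟨⟨0, hN⟩⟩
  refine Finset.sum_pos (fun j _ => ?_) Finset.univ_nonempty
  have h1 : 0 < (N + m).choose j := Nat.choose_pos (by omega)
  have h2 : 0 < (N + m - j - 1).choose (N - j - 1) := Nat.choose_pos (by omega)
  have := hc j
  positivity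

theorem bombieri_sum_pow_le (n m : ℕ) (b : Fin (n + 1) → Fin d → ℂ) (σ : ℝ) (hσ : 0 ≤ σ)
    (hb : ∀ l, √(∑ i, ‖b l i‖ ^ 2) ≤ σ) (v : Fin (n + 1) → ℂ) :
    bombieri (n + 1 + m) (∑ l, C (v l) * linForm (b l) ^ (n + 1 + m)) ≤
      ∑ j : Fin (n + 1), remCount (n + 1) (m + 1) j * σ ^ (n + 1 + m - j) *
        bombieri j (∑ l, C (v l) * linForm (b l) ^ (j : ℕ)) := by
  set b' : ℕ → Fin d → ℂ := fun l => if h : l < n + 1 then b ⟨l, h⟩ else 0 with hb'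
  have hbb (l : Fin (n + 1)) : b' l = b l := dif_pos l.2
  have hb'σ (l : ℕ) : √(∑ i, ‖b' l i‖ ^ 2) ≤ σ := by
    by_cases h : l < n + 1
    · simpa only [hb', dif_pos h] using hb ⟨l, h⟩
    · simpa only [hb', dif_neg h, Pi.zero_apply, norm_zero, ne_eq, OfNat.ofNat_ne_zero,
        not_false_eq_true, zero_pow, Finset.sum_const_zero, Real.sqrt_zero] using hσ
  have key : ∑ l, C (v l) * linForm (b l) ^ (n + 1 + m) =
      ∑ j : Fin (n + 1), remCoeff (fun l => linForm (b' l)) (n + 1) (m + 1) j *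
        ∑ l, C (v l) * linForm (b l) ^ (j : ℕ) := by
    simp_rw [Finset.mul_sum]
    rw [Finset.sum_comm]
    refine Finset.sum_congr rfl fun l _ => ?_
    have := pow_eq_sum_remCoeff (fun l => linForm (b' l)) (m + 1) n l (by omega)
    rw [Finset.sum_range] at this
    simp only [hbb] at this
    rw [show n + 1 + m = n + (m + 1) by omega, this, Finset.mul_sum]
    exact Finset.sum_congr rfl fun j _ => by ring
  rw [key]
  refine (bombieri_sum_le _ _ _).trans (Finset.sum_le_sum fun j _ => ?_)
  have := bombieri_remCoeff_mul_le b' σ hb'σ (n + 1) (m + 1) j (n + 1 + m - j) (by omega) j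
    (∑ l, C (v l) * linForm (b l) ^ (j : ℕ))
  rwa [show (j : ℕ) + (n + 1 + m - j) = n + 1 + m by omega] at this

end Bombieri

/-- The quadratic form of every Hadamard power `k ≥ N` is controlled by those of the first `N`. -/
theorem exists_quadForm_hadPow (ρ : ℝ) (hρ : 0 ≤ ρ) (N : ℕ) (hN : 1 ≤ N) (c : Fin N → ℝ)
    (hc : ∀ j, 0 < c j) (A : Matrix (Fin N) (Fin N) ℂ) (hA : A.PosSemidef)
    (hAρ : ∀ i j, A i j ∈ Metric.closedBall (0 : ℂ) ρ) (v : Fin N → ℂ) :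
    ∃ q : ℕ → ℝ, (∀ k, 0 ≤ q k) ∧
      (∀ k, star v ⬝ᵥ (hadPow A k).mulVec v = (q k : ℂ)) ∧
      ∀ m, q (N + m) ≤ CC N c (N + m) ρ * ∑ j : Fin N, c j * q j := by
  obtain ⟨n, rfl⟩ : ∃ n, N = n + 1 := ⟨N - 1, by omega⟩
  obtain ⟨d, x, hx⟩ := Matrix.posSemidef_iff_eq_sum_vecMulVec.mp hA
  set b : Fin (n + 1) → Fin d → ℂ := fun l i => star (x i l) with hb
  have hAb (k l : Fin (n + 1)) : A k l = ∑ i, star (b k i) * b l i := by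
    simp [hx, hb, Matrix.sum_apply, Matrix.vecMulVec_apply]
  have hbσ (l : Fin (n + 1)) : √(∑ i, ‖b l i‖ ^ 2) ≤ √ρ := by
    apply Real.sqrt_le_sqrt
    have h : A l l = ((∑ i, ‖b l i‖ ^ 2 : ℝ) : ℂ) := by
      rw [hAb]
      push_cast
      exact Finset.sum_congr rfl fun i _ => Complex.conj_mul' _
    have h' := hAρ l l
    rw [mem_closedBall_zero_iff, h, Complex.norm_real, Real.norm_eq_abs] at h'
    exact (le_abs_self _).trans h'
  set B : ℕ → ℝ := fun k => bombieri k (∑ l, MvPolynomial.C (v l) * linForm (b l) ^ k) with hB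
  refine ⟨fun k => B k ^ 2, fun k => sq_nonneg _, fun k => ?_, fun m => ?_⟩
  · rw [hB, bombieri_sum_pow_sq]
    simp only [dotProduct, Matrix.mulVec, hadPow, Matrix.of_apply, hAb, Finset.mul_sum,
      Pi.star_apply, mul_assoc]
  · refine (pow_le_pow_left₀ (bombieri_nonneg _ _)
      (bombieri_sum_pow_le n m b (√ρ) (Real.sqrt_nonneg _) hbσ v) 2).trans ?_
    rw [CC_eq_sum_remCount]
    refine Finset.sum_sq_le_sum_mul_sum_of_sq_le_mul _ (fun j _ => ?_) (fun j _ => ?_)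
      fun j _ => ?_
    · have := hc j; positivity
    · have := hc j; positivity
    · have := (hc j).ne'
      apply le_of_eq
      rw [mul_pow, mul_pow, ← pow_mul, mul_comm _ 2, pow_mul, Real.sq_sqrt hρ]
      field_simp
      rfl

theorem hadPow_isHermitian {N : ℕ} {A : Matrix (Fin N) (Fin N) ℂ} (hA : A.IsHermitian) (k : ℕ) :
    (hadPow A k).IsHermitian := by
  ext i j
  simp only [Matrix.conjTranspose_apply, hadPow, Matrix.of_apply, star_pow, hA.apply]

/-- Rank-one matrices with distinct real nodes bound the admissible coefficient. -/
theorem mul_sum_remCoeff_sq_le_one (n m : ℕ) (c : Fin (n + 1) → ℝ) (hc : ∀ j, 0 < c j) (η : ℝ)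
    (w : ℕ → ℝ) (hw : Function.Injective w)
    (h : ∀ v : Fin (n + 1) → ℝ, 0 ≤ ∑ j : Fin (n + 1), c j * (∑ i, v i * w i ^ (j : ℕ)) ^ 2
      - η * (∑ i, v i * w i ^ (n + 1 + m)) ^ 2) :
    η * ∑ j : Fin (n + 1), remCoeff w (n + 1) (m + 1) j ^ 2 / c j ≤ 1 := by
  set α : Fin (n + 1) → ℝ := fun j => remCoeff w (n + 1) (m + 1) j with hα
  set V := Matrix.vandermonde fun i : Fin (n + 1) => w i with hV
  have hdet : IsUnit V.det := by
    rw [isUnit_iff_ne_zero, hV, Matrix.det_vandermonde_ne_zero_iff]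
    exact fun i j hij => Fin.ext (hw hij)
  set v : Fin (n + 1) → ℝ := Matrix.vecMul (fun j => α j / c j) V⁻¹ with hv
  have hvw (j : Fin (n + 1)) : ∑ i, v i * w i ^ (j : ℕ) = α j / c j := by
    have h1 : Matrix.vecMul v V = fun j => α j / c j := by
      rw [hv, Matrix.vecMul_vecMul, Matrix.nonsing_inv_mul _ hdet, Matrix.vecMul_one]
    simpa [Matrix.vecMul, dotProduct, hV, Matrix.vandermonde_apply] using congrFun h1 j
  have hM : ∑ i, v i * w i ^ (n + 1 + m) = ∑ j, α j ^ 2 / c j := by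
    have h1 (i : Fin (n + 1)) : w i ^ (n + 1 + m) = ∑ j, α j * w i ^ (j : ℕ) := by
      have := pow_eq_sum_remCoeff w (m + 1) n i (by omega)
      rwa [Finset.sum_range, show n + (m + 1) = n + 1 + m by omega] at this
    simp_rw [h1, Finset.mul_sum]
    rw [Finset.sum_comm]
    refine Finset.sum_congr rfl fun j _ => ?_
    simp_rw [mul_left_comm _ (α j)]
    rw [← Finset.mul_sum, hvw]
    ring
  have h2 := h v
  have h3 : ∑ j : Fin (n + 1), c j * (α j / c j) ^ 2 = ∑ j, α j ^ 2 / c j :=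
    Finset.sum_congr rfl fun j _ => by have := (hc j).ne'; field_simp
  simp_rw [hvw] at h2
  rw [hM, h3] at h2
  have h4 : 0 ≤ ∑ j, α j ^ 2 / c j :=
    Finset.sum_nonneg fun j _ => div_nonneg (sq_nonneg _) (hc j).le
  change η * ∑ j, α j ^ 2 / c j ≤ 1
  by_contra! hlt
  rcases h4.eq_or_lt with h5 | h5
  · rw [← h5] at hlt; linarith
  · nlinarith

theorem mul_CC_le_one (ρ : ℝ) (hρ : 0 < ρ) (n m : ℕ) (c : Fin (n + 1) → ℝ) (hc : ∀ j, 0 < c j)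
    (η : ℝ) (h : ∀ w : ℕ → ℝ, (∀ i ≤ n, |w i| ≤ √ρ) → ∀ v : Fin (n + 1) → ℝ,
      0 ≤ ∑ j : Fin (n + 1), c j * (∑ i, v i * w i ^ (j : ℕ)) ^ 2
        - η * (∑ i, v i * w i ^ (n + 1 + m)) ^ 2) :
    η * CC (n + 1) c (n + 1 + m) ρ ≤ 1 := by
  set w : ℝ → ℕ → ℝ := fun ε i => √ρ * (1 - ε * i) with hw
  have hsρ : 0 < √ρ := Real.sqrt_pos.mpr hρ
  have hcont : Continuous fun ε : ℝ =>
      η * ∑ j : Fin (n + 1), remCoeff (w ε) (n + 1) (m + 1) j ^ 2 / c j := by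
    have (j : ℕ) := continuous_remCoeff w (fun i => by fun_prop) (n + 1) (m + 1) j
    fun_prop
  have h0 : η * CC (n + 1) c (n + 1 + m) ρ =
      η * ∑ j : Fin (n + 1), remCoeff (w 0) (n + 1) (m + 1) j ^ 2 / c j := by
    rw [CC_eq_sum_remCount]
    congr 1
    refine Finset.sum_congr rfl fun j _ => ?_
    have hw0 : w 0 = fun _ => √ρ := by ext i; simp [hw]
    rw [hw0, remCoeff_const _ _ _ _ (n + 1 + m - j) (by omega), mul_pow, mul_pow, ← pow_mul,
      mul_comm _ 2, pow_mul, ← pow_mul (√ρ), mul_comm _ 2, pow_mul (√ρ), Real.sq_sqrt hρ.le]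
    simp
  rw [h0]
  refine le_of_tendsto (hcont.tendsto 0 |>.mono_left (nhdsWithin_le_nhds (s := Set.Ioi 0))) ?_
  have hn : (0 : ℝ) < 1 / (n + 1) := by positivity
  filter_upwards [Ioo_mem_nhdsGT hn] with ε hε
  refine mul_sum_remCoeff_sq_le_one n m c hc η (w ε) (fun i j hij => ?_) (h _ fun i hi => ?_)
  · have := mul_left_cancel₀ hsρ.ne' hij
    have h1 : ε * (i : ℝ) = ε * j := by linarith
    exact_mod_cast mul_left_cancel₀ hε.1.ne' h1
  · have hi' : (i : ℝ) ≤ n := by exact_mod_cast hi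
    have h1 : ε * (n + 1) < 1 := by have := hε.2; rwa [lt_div_iff₀ (by positivity)] at this
    have h2 : ε * i ≤ ε * n := mul_le_mul_of_nonneg_left hi' hε.1.le
    have h3 : 0 ≤ ε * i := mul_nonneg hε.1.le (Nat.cast_nonneg i)
    have h4 := hε.1
    rw [hw, abs_of_nonneg (mul_nonneg hsρ.le (by linarith))]
    nlinarith

theorem stmt_4 (ρ : ℝ) (hρ : 0 < ρ) (N M : ℕ) (hN : 1 ≤ N)
    (c : Fin N → ℝ) (hc : ∀ j, 0 < c j) (η : ℝ) (hη : 0 < η) :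
    (η ≤ (∑ m : Fin (M + 1), CC N c (N + (m : ℕ)) ρ)⁻¹ →
      ∀ A : Matrix (Fin N) (Fin N) ℂ, A.PosSemidef →
        (∀ i j, A i j ∈ Metric.closedBall (0 : ℂ) ρ) →
        ∀ u : Fin (M + 1) → ℝ, (∀ m, |u m| ≤ η) →
        (∑ j : Fin N, (c j : ℂ) • hadPow A (j : ℕ)
          + ∑ m : Fin (M + 1), (u m : ℂ) • hadPow A (N + (m : ℕ))).PosSemidef)
    ∧ ((∀ A : Matrix (Fin N) (Fin N) ℂ, A.PosSemidef →
        (∀ i j, A i j ∈ Metric.closedBall (0 : ℂ) ρ) →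
        ∀ u : Fin (M + 1) → ℝ, (∀ m, |u m| ≤ η) →
        (∑ j : Fin N, (c j : ℂ) • hadPow A (j : ℕ)
          + ∑ m : Fin (M + 1), (u m : ℂ) • hadPow A (N + (m : ℕ))).PosSemidef) →
      η ≤ (CC N c (N + M) ρ)⁻¹) := by
  constructor
  · intro hηC A hA hAρ u hu
    have hCC (m : ℕ) := CC_pos N m hN c hc ρ hρ
    have hS : 0 < ∑ m : Fin (M + 1), CC N c (N + (m : ℕ)) ρ :=
      Finset.sum_pos (fun m _ => hCC m) Finset.univ_nonempty
    rw [le_inv_comm₀ hη hS, ← one_div, le_div_iff₀ hη] at hηC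
    have hherm (r : ℝ) (k : ℕ) : ((r : ℂ) • hadPow A k).IsHermitian := by
      have := hadPow_isHermitian hA.isHermitian k
      ext i j
      simp [Matrix.conjTranspose_apply, this.apply]
    refine Matrix.PosSemidef.of_dotProduct_mulVec_nonneg (.add ?_ ?_) fun v => ?_
    · exact isSelfAdjoint_sum _ fun j _ => hherm _ _
    · exact isSelfAdjoint_sum _ fun j _ => hherm _ _
    obtain ⟨q, hq0, hq, hqC⟩ := exists_quadForm_hadPow ρ hρ.le N hN c hc A hA hAρ v
    have hval : star v ⬝ᵥ (∑ j : Fin N, (c j : ℂ) • hadPow A (j : ℕ)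
          + ∑ m : Fin (M + 1), (u m : ℂ) • hadPow A (N + (m : ℕ))).mulVec v
        = ((∑ j : Fin N, c j * q j + ∑ m : Fin (M + 1), u m * q (N + m) : ℝ) : ℂ) := by
      simp [Matrix.add_mulVec, Matrix.sum_mulVec, Matrix.smul_mulVec, dotProduct_add,
        dotProduct_sum, dotProduct_smul, hq]
    rw [hval]
    refine Complex.zero_le_real.mpr ?_
    have hQ : 0 ≤ ∑ j : Fin N, c j * q j :=
      Finset.sum_nonneg fun j _ => mul_nonneg (hc j).le (hq0 _)
    have hbound : ∑ m : Fin (M + 1), -(u m * q (N + m)) ≤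
        ∑ m : Fin (M + 1), η * (CC N c (N + m) ρ * ∑ j : Fin N, c j * q j) := by
      refine Finset.sum_le_sum fun m _ => ?_
      rw [← neg_mul]
      exact mul_le_mul ((neg_le_abs _).trans (hu m)) (hqC m) (hq0 _) hη.le
    rw [Finset.sum_neg_distrib, ← Finset.mul_sum, ← Finset.sum_mul] at hbound
    nlinarith
  · intro h
    rw [le_inv_comm₀ hη (CC_pos N M hN c hc ρ hρ), ← one_div, le_div_iff₀ hη, mul_comm]
    obtain ⟨n, rfl⟩ : ∃ n, N = n + 1 := ⟨N - 1, by omega⟩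
    refine mul_CC_le_one ρ hρ n M c hc η fun w hw v => ?_
    set a : Fin (n + 1) → ℂ := fun i => (w i : ℂ) with ha
    have hpsd := h (Matrix.vecMulVec a (star a)) (Matrix.posSemidef_vecMulVec_self_star a)
      (fun i j => ?_) (fun m => if m = Fin.last M then -η else 0) fun m => ?_
    · have hv := hpsd.dotProduct_mulVec_nonneg fun i => (v i : ℂ)
      have hpow (k : ℕ) : (star fun i => (v i : ℂ)) ⬝ᵥ
          (hadPow (Matrix.vecMulVec a (star a)) k).mulVec (fun i => (v i : ℂ))
          = (((∑ i, v i * w i ^ k) ^ 2 : ℝ) : ℂ) := by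
        rw [sq, Finset.sum_mul_sum]
        push_cast
        simp only [dotProduct, Matrix.mulVec, hadPow, Matrix.of_apply, Finset.mul_sum,
          Pi.star_apply, Matrix.vecMulVec_apply, ha]
        refine Finset.sum_congr rfl fun i _ => Finset.sum_congr rfl fun j _ => ?_
        simp
        ring
      rw [← Complex.zero_le_real]
      convert hv using 1
      rw [Matrix.add_mulVec, Matrix.sum_mulVec, Matrix.sum_mulVec, dotProduct_add,
        dotProduct_sum, dotProduct_sum]
      simp only [Matrix.smul_mulVec, dotProduct_smul, hpow, smul_eq_mul]
      rw [Finset.sum_eq_single (Fin.last M) (fun m _ hm => by simp [hm]) (by simp)]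
      simp
      ring
    · rw [mem_closedBall_zero_iff]
      have hi := hw i (by omega)
      have hj := hw j (by omega)
      simp only [Matrix.vecMulVec_apply, ha, Pi.star_apply, norm_mul, norm_star,
        Complex.norm_real, Real.norm_eq_abs]
      calc |w i| * |w j| ≤ √ρ * √ρ := mul_le_mul hi hj (abs_nonneg _) (Real.sqrt_nonneg _)
        _ = ρ := Real.mul_self_sqrt hρ.le
    · split_ifs
      · rw [abs_neg, abs_of_pos hη]
      · simpa using hη.le
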